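/- liminf_{n→∞} (f(n) − n)/√n ≥ √(2 + 40/99), where f(n) is the maximum number of edges in an n-vertex graph in which no two cycles have the same length. -/

import Mathlib

open SimpleGraph Filter

/-- A graph has all cycles of distinct lengths. -/
def distinctCycleLengths {V : Type*} (G : SimpleGraph V) : Prop :=
  ∀ (u v : V) (w : G.Walk u u) (w' : G.Walk v v), w.IsCycle → w'.IsCycle →
    w.length = w'.length → {e | e ∈ w.edges} = {e | e ∈ w'.edges}

/-- `f n` is the maximum number of edges in an `n`-vertex graph all of whose
cycles have distinct lengths. -/
noncomputable def f (n : ℕ) : ℕ :=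
  sSup {e | ∃ G : SimpleGraph (Fin n), distinctCycleLengths G ∧ G.edgeSet.ncard = e}

/-! ### Upper bound: `f n ≤ n + O(√n)` -/

/-- Random (derandomised) cover of a family of sets. -/
lemma exists_light_cover {α ι : Type*} [DecidableEq α] (p : ℝ) (hp0 : 0 ≤ p) (hp1 : p ≤ 1)
    (E : Finset α) : ∀ (I : Finset ι) (C : ι → Finset α), (∀ i ∈ I, C i ⊆ E) →
    ∃ A ⊆ E, (A.card : ℝ) + ((I.filter (fun i => Disjoint (C i) A)).card : ℝ) ≤
      p * E.card + ∑ i ∈ I, (1 - p) ^ (C i).card := by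
  classical
  induction E using Finset.induction_on with
  | empty =>
    intro I C hC
    refine ⟨∅, by simp, ?_⟩
    have h1 : ∀ i ∈ I, (1 - p) ^ (C i).card = 1 := by
      intro i hi
      have : C i = ∅ := Finset.subset_empty.mp (hC i hi)
      simp [this]
    rw [Finset.sum_congr rfl h1]
    simp
  | insert e E he ih =>
    intro I C hC
    -- option 1 : take e
    set J := I.filter (fun i => e ∉ C i) with hJ
    obtain ⟨A1, hA1, h1⟩ := ih J C (by
      intro i hi
      rw [hJ, Finset.mem_filter] at hi
      intro x hx
      have := hC i hi.1 hx
      rcases Finset.mem_insert.mp this with h | h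
      · subst h; exact absurd hx hi.2
      · exact h)
    obtain ⟨A2, hA2, h2⟩ := ih I (fun i => (C i).erase e) (by
      intro i hi x hx
      rw [Finset.mem_erase] at hx
      have := hC i hi hx.2
      rcases Finset.mem_insert.mp this with h | h
      · exact absurd h hx.1
      · exact h)
    set S := ∑ i ∈ J, (1 - p) ^ (C i).card with hS
    set S' := ∑ i ∈ I.filter (fun i => e ∈ C i), (1 - p) ^ ((C i).erase e).card with hS'
    have e1 : ∑ i ∈ I, (1 - p) ^ (C i).card = S + (1 - p) * S' := by
      rw [hS, hS', Finset.mul_sum, hJ, ← Finset.sum_filter_add_sum_filter_not I (fun i => e ∈ C i),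
        add_comm]
      congr 1
      apply Finset.sum_congr rfl
      intro i hi
      rw [Finset.mem_filter] at hi
      rw [← Finset.card_erase_add_one hi.2, pow_succ]
      ring
    have e2 : ∑ i ∈ I, (1 - p) ^ ((C i).erase e).card = S + S' := by
      rw [hS, hS', hJ, ← Finset.sum_filter_add_sum_filter_not I (fun i => e ∈ C i), add_comm]
      congr 1
      apply Finset.sum_congr rfl
      intro i hi
      rw [Finset.mem_filter] at hi
      rw [Finset.erase_eq_of_notMem hi.2]
    rw [e1, Finset.card_insert_of_notMem he]
    simp only [e2] at h2
    by_cases hc : 1 ≤ S'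
    · refine ⟨insert e A1, Finset.insert_subset_insert _ hA1, ?_⟩
      have he1 : e ∉ A1 := fun h => he (hA1 h)
      rw [Finset.card_insert_of_notMem he1]
      have : (I.filter (fun i => Disjoint (C i) (insert e A1))) =
          J.filter (fun i => Disjoint (C i) A1) := by
        ext i
        simp only [hJ, Finset.mem_filter, Finset.disjoint_insert_right]
        tauto
      rw [this]
      push_cast
      nlinarith
    · refine ⟨A2, hA2.trans (Finset.subset_insert _ _), ?_⟩
      have he2 : e ∉ A2 := fun h => he (hA2 h)
      have : (I.filter (fun i => Disjoint (C i) A2)) =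
          I.filter (fun i => Disjoint ((C i).erase e) A2) := by
        ext i
        simp only [Finset.mem_filter, and_congr_right_iff]
        intro _
        rw [Finset.disjoint_left, Finset.disjoint_left]
        constructor
        · intro h a ha
          exact h (Finset.mem_of_mem_erase ha)
        · intro h a ha hA
          refine h (Finset.mem_erase.mpr ⟨?_, ha⟩) hA
          rintro rfl
          exact he2 hA
      rw [this]
      push_cast
      push Not at hc
      nlinarith

lemma acyclic_ncard_le {n : ℕ} (hn : 1 ≤ n) (G : SimpleGraph (Fin n)) (hG : G.IsAcyclic) :
    G.edgeSet.ncard + 1 ≤ n := by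
  classical
  have : Nonempty (Fin n) := ⟨⟨0, hn⟩⟩
  obtain ⟨T, h1, h2⟩ := Connected.exists_isTree_le_of_le_of_isAcyclic (G := (⊤ : SimpleGraph (Fin n)))
    (H := G) connected_top le_top hG
  have h3 := h2.2.card_edgeFinset
  have h4 : G.edgeSet.ncard ≤ T.edgeSet.ncard :=
    Set.ncard_le_ncard (edgeSet_subset_edgeSet.mpr h1) (Set.toFinite _)
  have h5 : T.edgeSet.ncard = T.edgeFinset.card := by
    rw [← SimpleGraph.coe_edgeFinset, Set.ncard_coe_finset]
  rw [Fintype.card_fin] at h3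
  omega

lemma edges_upper {n : ℕ} (hn : 1 ≤ n) (G : SimpleGraph (Fin n)) (hG : distinctCycleLengths G) :
    (G.edgeSet.ncard : ℝ) ≤ n + 2 * Real.sqrt G.edgeSet.ncard := by
  classical
  set E : Finset (Sym2 (Fin n)) := G.edgeFinset with hE
  have hm : G.edgeSet.ncard = E.card := by
    rw [← SimpleGraph.coe_edgeFinset, Set.ncard_coe_finset]
  rcases Nat.eq_zero_or_pos E.card with h0 | hpos
  · rw [hm, h0]; simp
  set m := E.card with hmdef
  have hm1 : (1 : ℝ) ≤ m := by exact_mod_cast hpos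
  set s := Real.sqrt m with hs
  have hss : s * s = m := Real.mul_self_sqrt (by positivity)
  have hs1 : 1 ≤ s := by
    rw [hs]; exact Real.one_le_sqrt.mpr hm1
  set P : ℕ → Prop := fun l => ∃ (u : Fin n) (w : G.Walk u u), w.IsCycle ∧ w.length = l with hP
  set I := (Finset.range (m + 1)).filter P with hI
  have hch : ∀ l, ∃ C : Finset (Sym2 (Fin n)), P l → (C ⊆ E ∧ C.card = l ∧
      ∀ (u : Fin n) (w : G.Walk u u), w.IsCycle → w.length = l → {e | e ∈ w.edges} = (C : Set _)) := by
    intro l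
    by_cases h : P l
    · obtain ⟨u, w, hw, hl⟩ := h
      refine ⟨w.edges.toFinset, fun _ => ⟨?_, ?_, ?_⟩⟩
      · intro e he
        rw [List.mem_toFinset] at he
        rw [hE, mem_edgeFinset]
        exact w.edges_subset_edgeSet he
      · rw [List.toFinset_card_of_nodup hw.isTrail.edges_nodup, Walk.length_edges, hl]
      · intro u' w' hw' hl'
        rw [hG u' u w' w hw' hw (hl'.trans hl.symm)]
        ext e; simp
    · exact ⟨∅, fun h' => absurd h' h⟩
  choose C hC using hch
  have hsinv : s⁻¹ ≤ 1 := inv_le_one_of_one_le₀ hs1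
  have hsinv0 : 0 < s⁻¹ := by positivity
  obtain ⟨A, hAE, hA⟩ := exists_light_cover s⁻¹ hsinv0.le hsinv E I C (by
    intro i hi
    rw [hI, Finset.mem_filter] at hi
    exact (hC i hi.2).1)
  have hsum : ∑ i ∈ I, (1 - s⁻¹) ^ (C i).card ≤ s := by
    calc ∑ i ∈ I, (1 - s⁻¹) ^ (C i).card = ∑ i ∈ I, (1 - s⁻¹) ^ i := by
          apply Finset.sum_congr rfl
          intro i hi
          rw [hI, Finset.mem_filter] at hi
          rw [(hC i hi.2).2.1]
      _ ≤ ∑ i ∈ Finset.range (m + 1), (1 - s⁻¹) ^ i := by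
          apply Finset.sum_le_sum_of_subset_of_nonneg (Finset.filter_subset _ _)
          intro i _ _
          exact pow_nonneg (by linarith) _
      _ ≤ s := by
          have h := geom_sum_mul (1 - s⁻¹) (m + 1)
          have h' : (∑ i ∈ Finset.range (m + 1), (1 - s⁻¹) ^ i) * s⁻¹ ≤ 1 := by
            have : (0 : ℝ) ≤ (1 - s⁻¹) ^ (m + 1) := pow_nonneg (by linarith) _
            linarith
          rw [← div_eq_mul_inv, div_le_one (by linarith)] at h'
          exact h'
  have hcost : s⁻¹ * (E.card : ℝ) = s := by
    rw [← hmdef, ← hss]; field_simp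
  rw [hcost] at hA
  -- the cover
  set U := I.filter (fun i => Disjoint (C i) A) with hU
  have hpick : ∀ l, ∃ e : Sym2 (Fin n), P l → e ∈ C l := by
    intro l
    by_cases h : P l
    · have h2 := hC l h
      obtain ⟨u, w, hw, hl⟩ := h
      have h3 : (C l).Nonempty := by
        rw [← Finset.card_pos, h2.2.1, ← hl]
        have := hw.three_le_length
        omega
      exact ⟨h3.choose, fun _ => h3.choose_spec⟩
    · have : Nonempty (Sym2 (Fin n)) := ⟨s(⟨0, hn⟩, ⟨0, hn⟩)⟩
      exact ⟨this.some, fun h' => absurd h' h⟩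
  choose g hg using hpick
  set F := A ∪ U.image g with hF
  have hFcard : (F.card : ℝ) ≤ 2 * s := by
    have h1 : F.card ≤ A.card + U.card :=
      (Finset.card_union_le _ _).trans (Nat.add_le_add_left Finset.card_image_le _)
    have h2 : (F.card : ℝ) ≤ A.card + U.card := by exact_mod_cast h1
    linarith
  have hac : (G.deleteEdges (F : Set (Sym2 (Fin n)))).IsAcyclic := by
    intro u w hw
    have hle : G.deleteEdges (F : Set (Sym2 (Fin n))) ≤ G := G.deleteEdges_le _
    have hw2 : (w.mapLe hle).IsCycle := hw.mapLe hle
    have hPl : P w.length := ⟨u, w.mapLe hle, hw2, by simp⟩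
    have hCl := hC _ hPl
    have hset := hCl.2.2 u (w.mapLe hle) hw2 (by simp)
    have hedge : ∀ e ∈ C w.length, e ∉ F := by
      intro e he
      have : e ∈ {e | e ∈ (w.mapLe hle).edges} := by rw [hset]; exact he
      simp only [Set.mem_ofPred_eq, Walk.edges_mapLe_eq_edges] at this
      have h3 := w.edges_subset_edgeSet this
      rw [edgeSet_deleteEdges] at h3
      intro h4
      exact h3.2 h4
    have hlI : w.length ∈ I := by
      rw [hI, Finset.mem_filter]
      refine ⟨?_, hPl⟩
      rw [Finset.mem_range]
      have := Finset.card_le_card hCl.1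
      rw [hCl.2.1] at this
      omega
    by_cases hd : Disjoint (C w.length) A
    · have hmem : w.length ∈ U := by rw [hU, Finset.mem_filter]; exact ⟨hlI, hd⟩
      exact hedge _ (hg _ hPl) (Finset.mem_union_right _ (Finset.mem_image_of_mem g hmem))
    · rw [Finset.not_disjoint_iff] at hd
      obtain ⟨e, he, heA⟩ := hd
      exact hedge e he (Finset.mem_union_left _ heA)
  have hk := acyclic_ncard_le hn _ hac
  have hEset : G.edgeSet = (E : Set (Sym2 (Fin n))) := by rw [hE, SimpleGraph.coe_edgeFinset]
  rw [edgeSet_deleteEdges, hEset, ← Finset.coe_sdiff, Set.ncard_coe_finset] at hk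
  have hk2 : E.card ≤ (E \ F).card + F.card := by
    have := Finset.le_card_sdiff F E
    omega
  have hk3 : (m : ℝ) ≤ n + F.card := by
    have : m ≤ n + F.card := by omega
    exact_mod_cast this
  rw [hm]
  linarith

lemma f_upper {n : ℕ} (hn : 1 ≤ n) : (f n : ℝ) - n ≤ 5 * Real.sqrt n := by
  have hmem : f n ∈ {e | ∃ G : SimpleGraph (Fin n), distinctCycleLengths G ∧ G.edgeSet.ncard = e} := by
    apply Nat.sSup_mem
    · refine ⟨_, ⊥, ?_, rfl⟩
      intro u v w w' hw
      exact absurd rfl hw.ne_bot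
    · refine ⟨Nat.card (Sym2 (Fin n)), ?_⟩
      rintro e ⟨G, _, rfl⟩
      rw [← Set.ncard_univ]
      exact Set.ncard_le_ncard (Set.subset_univ _) (Set.toFinite _)
  obtain ⟨G, hG, he⟩ := hmem
  have h := edges_upper hn G hG
  rw [he] at h
  have hn1 : (1 : ℝ) ≤ n := by exact_mod_cast hn
  set s := Real.sqrt (f n) with hs
  set t := Real.sqrt n with ht
  have hss : s * s = f n := Real.mul_self_sqrt (by positivity)
  have htt : t * t = n := Real.mul_self_sqrt (by positivity)
  have ht1 : 1 ≤ t := Real.one_le_sqrt.mpr hn1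
  have hs0 : 0 ≤ s := Real.sqrt_nonneg _
  have : s ≤ t * (5/2) := by
    by_contra hc
    push Not at hc
    nlinarith
  linarith

lemma le_f {n : ℕ} (G : SimpleGraph (Fin n)) (hG : distinctCycleLengths G) :
    G.edgeSet.ncard ≤ f n := by
  apply le_csSup
  · refine ⟨Nat.card (Sym2 (Fin n)), ?_⟩
    rintro e ⟨G, _, rfl⟩
    rw [← Set.ncard_univ]
    exact Set.ncard_le_ncard (Set.subset_univ _) (Set.toFinite _)
  · exact ⟨G, hG, rfl⟩

/-! ### Spider graphs: legs at a common hub, consecutive legs of a block joined by links -/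

section Spider

/-- Vertex at height `s` of leg `m` of block `b`; height `0` is the hub. -/
def pt {ι : Type*} (b : ι) (m s : ℕ) : Option (ι × ℕ × ℕ) := if s = 0 then none else some (b, m, s)

/-- Block `b` has legs `0, …, k b`, leg `m` has height `h b m`, and the top of leg `m` is linked
to the vertex at height `q b (m+1)` of leg `m+1`. -/
def spider {ι : Type*} (k : ι → ℕ) (h q : ι → ℕ → ℕ) : SimpleGraph (Option (ι × ℕ × ℕ)) :=
  SimpleGraph.fromRel (fun x y =>
    (∃ b m s, m ≤ k b ∧ s < h b m ∧ x = pt b m s ∧ y = pt b m (s + 1)) ∨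
    (∃ b m, m < k b ∧ x = pt b m (h b m) ∧ y = pt b (m + 1) (q b (m + 1))))

/-- Admissibility of the parameters of a spider graph. -/
def Adm {ι : Type*} (k : ι → ℕ) (h q : ι → ℕ → ℕ) : Prop :=
  (∀ b m, m < k b → 1 ≤ q b (m + 1) ∧ q b (m + 1) ≤ h b (m + 1)) ∧ (∀ b, 1 ≤ k b → 1 ≤ h b 0)

lemma Adm.pos {ι : Type*} {k : ι → ℕ} {h q : ι → ℕ → ℕ} (ha : Adm k h q) (b : ι) (m : ℕ)
    (hk : 1 ≤ k b) (hm : m ≤ k b) : 1 ≤ h b m := by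
  cases m with
  | zero => exact ha.2 b hk
  | succ m => have := ha.1 b m hm; omega

lemma pt_zero {ι : Type*} (b : ι) (m : ℕ) : pt b m 0 = none := rfl
lemma pt_succ {ι : Type*} (b : ι) (m s : ℕ) : pt b m (s + 1) = some (b, m, s + 1) := rfl
lemma pt_pos {ι : Type*} (b : ι) (m s : ℕ) (hs : 1 ≤ s) : pt b m s = some (b, m, s) := by
  unfold pt; rw [if_neg (by omega)]

lemma pt_eq_some {ι : Type*} {b b' : ι} {m s m' s' : ℕ} :
    some (b', m', s') = pt b m s ↔ b' = b ∧ m' = m ∧ s' = s ∧ 1 ≤ s := by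
  unfold pt
  split_ifs with h
  · simp; omega
  · simp; omega

lemma par3 {α : Type*} {N : Set α} (hN : N = ∅ ∨ N.ncard = 2) {a b c : α} (hab : a ≠ b)
    (hac : a ≠ c) (hbc : b ≠ c) (hsub : ∀ x ∈ N, x = a ∨ x = b ∨ x = c) :
    (a ∈ N ↔ Xor (b ∈ N) (c ∈ N)) := by
  rcases hN with rfl | hN
  · simp
  · obtain ⟨x, y, hxy, rfl⟩ := Set.ncard_eq_two.mp hN
    have hx := hsub x (by simp)
    have hy := hsub y (by simp)
    simp only [Set.mem_insert_iff, Set.mem_singleton_iff, Xor]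
    grind

variable {ι : Type*} {k : ι → ℕ} {h q : ι → ℕ → ℕ}

/-- The vertex above height `s` in leg `m`. -/
def upv (h q : ι → ℕ → ℕ) (b : ι) (m s : ℕ) : Option (ι × ℕ × ℕ) :=
  if s < h b m then some (b, m, s + 1) else some (b, m + 1, q b (m + 1))

/-- The top of the previous leg. -/
def sidev (h : ι → ℕ → ℕ) (b : ι) : ℕ → Option (ι × ℕ × ℕ)
  | 0 => some (b, 7, 0)
  | m + 1 => some (b, m, h b m)

/-- Whether `H` uses the link entering leg `m`. -/
def Zl (k : ι → ℕ) (h q : ι → ℕ → ℕ) (H : Option (ι × ℕ × ℕ) → Option (ι × ℕ × ℕ) → Prop)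
    (b : ι) : ℕ → Prop
  | 0 => False
  | m + 1 => m < k b ∧ H (pt b m (h b m)) (pt b (m + 1) (q b (m + 1)))

lemma spider_tree {b : ι} {m s : ℕ} (hm : m ≤ k b) (hs : s < h b m) :
    (spider k h q).Adj (pt b m s) (pt b m (s + 1)) := by
  unfold spider
  rw [SimpleGraph.fromRel_adj]
  refine ⟨?_, Or.inl (Or.inl ⟨b, m, s, hm, hs, rfl, rfl⟩)⟩
  rw [pt_succ]
  intro he
  have := pt_eq_some.mp he.symm
  omega

lemma spider_link (ha : Adm k h q) {b : ι} {m : ℕ} (hm : m < k b) :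
    (spider k h q).Adj (pt b m (h b m)) (pt b (m + 1) (q b (m + 1))) := by
  unfold spider
  rw [SimpleGraph.fromRel_adj]
  refine ⟨?_, Or.inl (Or.inr ⟨b, m, hm, rfl, rfl⟩)⟩
  rw [pt_pos b m _ (ha.pos b m (by omega) hm.le)]
  intro he
  have := pt_eq_some.mp he
  omega

/-- Neighbours of a non-hub vertex. -/
lemma spider_nbr (ha : Adm k h q) {b : ι} {m s : ℕ} {y : Option (ι × ℕ × ℕ)}
    (hadj : (spider k h q).Adj (some (b, m, s)) y) :
    1 ≤ s ∧ m ≤ k b ∧ s ≤ h b m ∧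
    (y = pt b m (s - 1) ∨ (s < h b m ∧ y = some (b, m, s + 1)) ∨
      (s = h b m ∧ m < k b ∧ y = some (b, m + 1, q b (m + 1))) ∨
      (∃ m', m = m' + 1 ∧ s = q b m ∧ y = some (b, m', h b m'))) := by
  unfold spider at hadj
  rw [SimpleGraph.fromRel_adj] at hadj
  obtain ⟨_, (⟨b', m', s', h1, h2, h3, h4⟩ | ⟨b', m', h1, h3, h4⟩) |
    (⟨b', m', s', h1, h2, h3, h4⟩ | ⟨b', m', h1, h3, h4⟩)⟩ := hadj
  · obtain ⟨rfl, rfl, rfl, h5⟩ := pt_eq_some.mp h3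
    exact ⟨h5, h1, h2.le, Or.inr (Or.inl ⟨h2, h4⟩)⟩
  · obtain ⟨rfl, rfl, rfl, h5⟩ := pt_eq_some.mp h3
    rw [pt_pos _ _ _ (ha.1 _ _ h1).1] at h4
    exact ⟨h5, h1.le, le_rfl, Or.inr (Or.inr (Or.inl ⟨rfl, h1, h4⟩))⟩
  · obtain ⟨rfl, rfl, rfl, h5⟩ := pt_eq_some.mp h4
    exact ⟨h5, h1, h2, Or.inl h3⟩
  · obtain ⟨rfl, rfl, rfl, h5⟩ := pt_eq_some.mp h4
    rw [pt_pos _ _ _ (ha.pos _ _ (by omega) h1.le)] at h3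
    exact ⟨h5, h1, (ha.1 _ _ h1).2, Or.inr (Or.inr (Or.inr ⟨m', rfl, rfl, h3⟩))⟩

/-- Neighbours of the hub. -/
lemma spider_nbr_hub (ha : Adm k h q) {y : Option (ι × ℕ × ℕ)}
    (hadj : (spider k h q).Adj none y) :
    ∃ b m, m ≤ k b ∧ 0 < h b m ∧ y = some (b, m, 1) := by
  unfold spider at hadj
  rw [SimpleGraph.fromRel_adj] at hadj
  obtain ⟨_, (⟨b', m', s', h1, h2, h3, h4⟩ | ⟨b', m', h1, h3, h4⟩) |
    (⟨b', m', s', h1, h2, h3, h4⟩ | ⟨b', m', h1, h3, h4⟩)⟩ := hadj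
  · cases s' with
    | zero => exact ⟨b', m', h1, h2, h4⟩
    | succ s => rw [pt_succ] at h3; cases h3
  · rw [pt_pos _ _ _ (ha.pos _ _ (by omega) h1.le)] at h3; cases h3
  · rw [pt_succ] at h4; cases h4
  · rw [pt_pos _ _ _ (ha.1 _ _ h1).1] at h4; cases h4

/-- A symmetric subrelation of the spider in which all degrees are `0` or `2`. -/
structure EvenSub (k : ι → ℕ) (h q : ι → ℕ → ℕ)
    (H : Option (ι × ℕ × ℕ) → Option (ι × ℕ × ℕ) → Prop) : Prop where
  symm : ∀ x y, H x y → H y x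
  sub : ∀ x y, H x y → (spider k h q).Adj x y
  deg : ∀ x, {y | H x y} = ∅ ∨ {y | H x y}.ncard = 2
  ne : ∃ x y, H x y

variable {H : Option (ι × ℕ × ℕ) → Option (ι × ℕ × ℕ) → Prop}

lemma mem_side (ha : Adm k h q) (hH : EvenSub k h q H) {b : ι} {m s : ℕ} :
    H (some (b, m, s + 1)) (sidev h b m) ↔ (s + 1 = q b m ∧ Zl k h q H b m) := by
  cases m with
  | zero =>
    simp only [sidev, Zl, and_false, iff_false]
    intro hc
    have h2 := spider_nbr ha (hH.sub _ _ hc)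
    obtain ⟨_, _, _, h3 | ⟨_, h3⟩ | ⟨_, _, h3⟩ | ⟨m', h4, _⟩⟩ := h2
    · have := pt_eq_some.mp h3; omega
    · simp at h3
    · simp at h3
    · omega
  | succ m =>
    simp only [sidev, Zl]
    constructor
    · intro hc
      have h2 := spider_nbr ha (hH.sub _ _ hc)
      obtain ⟨_, h0, _, h3 | ⟨_, h3⟩ | ⟨_, _, h3⟩ | ⟨m', h4, h5, _⟩⟩ := h2
      · have := pt_eq_some.mp h3; omega
      · simp at h3
      · simp at h3; omega
      · refine ⟨h5, h0, ?_⟩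
        rw [← h5, pt_pos _ _ _ (ha.pos b m (by omega) (by omega)), pt_succ]
        exact hH.symm _ _ hc
    · rintro ⟨h1, h2, h3⟩
      rw [← h1, pt_pos _ _ _ (ha.pos b m (by omega) (by omega)), pt_succ] at h3
      exact hH.symm _ _ h3

lemma mem_up (ha : Adm k h q) (hH : EvenSub k h q H) {b : ι} {m s : ℕ} (hs : s + 1 ≤ h b m) :
    H (some (b, m, s + 1)) (upv h q b m (s + 1)) ↔
      ((s + 1 < h b m ∧ H (pt b m (s + 1)) (pt b m (s + 2))) ∨
       (s + 1 = h b m ∧ Zl k h q H b (m + 1))) := by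
  by_cases h1 : s + 1 < h b m
  · have h2 : s + 1 ≠ h b m := by omega
    simp only [upv, h1, h2, if_true, true_and, false_and, or_false]
    rfl
  · have h2 : s + 1 = h b m := by omega
    have hh : upv h q b m (s + 1) = some (b, m + 1, q b (m + 1)) := by rw [upv, if_neg h1]
    rw [hh]
    constructor
    · intro hc
      obtain ⟨_, h0, _, h3 | ⟨_, h3⟩ | ⟨_, h4, h3⟩ | ⟨m', h4, h5, h6⟩⟩ := spider_nbr ha (hH.sub _ _ hc)
      · have := pt_eq_some.mp h3; omega
      · simp at h3
      · refine Or.inr ⟨h2, h4, ?_⟩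
        rw [← h2, pt_succ, pt_pos _ _ _ (ha.1 b m h4).1]
        exact hc
      · simp at h6; omega
    · rintro (⟨h5, _⟩ | ⟨_, h4, h5⟩)
      · exact absurd h5 h1
      · rw [pt_pos _ _ _ (ha.1 b m h4).1, ← h2, pt_succ] at h5
        exact h5

lemma nbr_three (ha : Adm k h q) (hH : EvenSub k h q H) {b : ι} {m s : ℕ}
    {y : Option (ι × ℕ × ℕ)} (hy : H (some (b, m, s + 1)) y) :
    y = pt b m s ∨ y = upv h q b m (s + 1) ∨ y = sidev h b m := by
  obtain ⟨_, h0, _, h3 | ⟨h4, h3⟩ | ⟨h5, h4, h3⟩ | ⟨m', h4, h5, h6⟩⟩ := spider_nbr ha (hH.sub _ _ hy)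
  · left; exact h3
  · right; left; rw [upv, if_pos h4]; exact h3
  · right; left; rw [upv, if_neg (by omega)]; exact h3
  · right; right; subst h4; exact h6

lemma step (ha : Adm k h q) (hH : EvenSub k h q H) {b : ι} {m s : ℕ} (hs : s + 1 ≤ h b m) :
    H (pt b m s) (pt b m (s + 1)) ↔
      Xor ((s + 1 < h b m ∧ H (pt b m (s + 1)) (pt b m (s + 2))) ∨
          (s + 1 = h b m ∧ Zl k h q H b (m + 1)))
        (s + 1 = q b m ∧ Zl k h q H b m) := by
  rw [← mem_side ha hH, ← mem_up ha hH hs]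
  have h0 : H (pt b m s) (pt b m (s + 1)) ↔ H (some (b, m, s + 1)) (pt b m s) :=
    ⟨fun hh => hH.symm _ _ hh, fun hh => hH.symm _ _ hh⟩
  rw [h0]
  refine par3 (N := {y | H (some (b, m, s + 1)) y}) (hH.deg _) ?_ ?_ ?_ ?_
  · intro he
    unfold upv at he
    split_ifs at he
    · have := pt_eq_some.mp he.symm; omega
    · have := pt_eq_some.mp he.symm; omega
  · intro he
    cases m with
    | zero => have := pt_eq_some.mp he.symm; omega
    | succ m => have := pt_eq_some.mp he.symm; omega
  · intro he
    unfold upv at he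
    cases m with
    | zero => split_ifs at he <;> simp [sidev] at he
    | succ m => split_ifs at he <;> simp [sidev] at he; omega
  · intro y hy
    exact nbr_three ha hH hy

lemma Zl_lt {b : ι} {m : ℕ} (hz : Zl k h q H b m) : 1 ≤ m ∧ m ≤ k b := by
  cases m with
  | zero => exact hz.elim
  | succ m => exact ⟨by omega, hz.1⟩

lemma tree_iff (ha : Adm k h q) (hH : EvenSub k h q H) {b : ι} {m : ℕ} :
    ∀ d s : ℕ, s + 1 + d = h b m →
    (H (pt b m s) (pt b m (s + 1)) ↔
      if s < q b m then Xor (Zl k h q H b (m + 1)) (Zl k h q H b m)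
      else Zl k h q H b (m + 1)) := by
  have hq : Zl k h q H b m → q b m ≤ h b m := by
    intro hz
    cases m with
    | zero => exact hz.elim
    | succ m => exact (ha.1 b m hz.1).2
  intro d
  induction d with
  | zero =>
    intro s hs
    rw [step ha hH (by omega)]
    have h1 : (s + 1 < h b m) = False := by simp; omega
    have h2 : (s + 1 = h b m) = True := by simp; omega
    rw [h1, h2]
    split_ifs with h3
    · by_cases hz : Zl k h q H b m
      · have := hq hz
        have h4 : (s + 1 = q b m) = True := by simp; omega
        rw [h4]; simp
      · simp [hz]
    · have h4 : (s + 1 = q b m) = False := by simp; omega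
      rw [h4]; simp [Xor]
  | succ d ih =>
    intro s hs
    rw [step ha hH (by omega), ih (s + 1) (by omega)]
    have h1 : s + 1 < h b m := by omega
    have h2 : ¬ (s + 1 = h b m) := by omega
    simp only [h1, h2, true_and, false_and, or_false]
    by_cases h5 : s < q b m
    · by_cases h4 : s + 1 = q b m
      · have h6 : ¬ (s + 1 < q b m) := by omega
        simp only [h5, h4, if_true, true_and]
        simp
      · have h6 : s + 1 < q b m := by omega
        simp [h5, h4, h6, Xor]
    · have h4 : s + 1 ≠ q b m := by omega
      have h6 : ¬ (s + 1 < q b m) := by omega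
      simp [h5, h4, h6, Xor]

lemma hub_iff (ha : Adm k h q) (hH : EvenSub k h q H) {b : ι} {m : ℕ} (hp : 0 < h b m) :
    H none (some (b, m, 1)) ↔ Xor (Zl k h q H b (m + 1)) (Zl k h q H b m) := by
  have h1 := tree_iff ha hH (b := b) (m := m) (h b m - 1) 0 (by omega)
  rw [pt_zero, pt_succ] at h1
  rw [h1]
  split_ifs with h2
  · rfl
  · cases m with
    | zero => simp [Zl, Xor]
    | succ m =>
      have : ¬ Zl k h q H b (m + 1) := by
        intro hz
        have := ha.1 b m hz.1
        omega
      simp [this, Xor]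

lemma exists_drop (P : ℕ → Prop) (h0 : ¬ P 0) (l : ℕ) (hl : P l) : ∃ i < l, ¬ P i ∧ P (i + 1) := by
  induction l with
  | zero => exact absurd hl h0
  | succ l ih =>
    by_cases hp : P l
    · obtain ⟨i, hi, h2⟩ := ih hp
      exact ⟨i, by omega, h2⟩
    · exact ⟨l, by omega, hp, hl⟩

lemma exists_rise (P : ℕ → Prop) (l d : ℕ) (hl : P l) (hd : ¬ P (l + d)) :
    ∃ j ≥ l, P j ∧ ¬ P (j + 1) := by
  induction d with
  | zero => exact absurd hl hd
  | succ d ih =>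
    by_cases hp : P (l + d)
    · exact ⟨l + d, by omega, hp, hd⟩
    · exact ih hp

lemma Zl_interval (ha : Adm k h q) (hH : EvenSub k h q H) :
    ∃ b i j, i < j ∧ j ≤ k b ∧ ∀ b' l, Zl k h q H b' l ↔ (b' = b ∧ i < l ∧ l ≤ j) := by
  -- some link is used
  have hex : ∃ b l, Zl k h q H b l := by
    obtain ⟨x, y, hxy⟩ := hH.ne
    have key : ∀ x y, H x y → ((∃ b m s, m ≤ k b ∧ s < h b m ∧ x = pt b m s ∧ y = pt b m (s + 1)) ∨
      (∃ b m, m < k b ∧ x = pt b m (h b m) ∧ y = pt b (m + 1) (q b (m + 1)))) →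
      ∃ b l, Zl k h q H b l := by
      rintro x y hxy (⟨b, m, s, h1, h2, rfl, rfl⟩ | ⟨b, m, h1, rfl, rfl⟩)
      · rw [tree_iff ha hH (h b m - s - 1) s (by omega)] at hxy
        split_ifs at hxy with h3
        · rcases hxy with hxy | hxy
          · exact ⟨_, _, hxy.1⟩
          · exact ⟨_, _, hxy.1⟩
        · exact ⟨_, _, hxy⟩
      · exact ⟨b, m + 1, h1, hxy⟩
    have hadj := hH.sub _ _ hxy
    unfold spider at hadj
    rw [SimpleGraph.fromRel_adj] at hadj
    rcases hadj.2 with h1 | h1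
    · exact key x y hxy h1
    · exact key y x (hH.symm _ _ hxy) h1
  obtain ⟨b, l, hl⟩ := hex
  obtain ⟨i, hi, hi0, hi1⟩ := exists_drop (Zl k h q H b) (fun hz => hz) l hl
  obtain ⟨j, hj, hj0, hj1⟩ := exists_rise (Zl k h q H b) l (k b + 1) hl (by
    intro hz
    have := Zl_lt hz
    omega)
  have hik := Zl_lt hi1
  have hjk := Zl_lt hj0
  have hposi := ha.pos b i (by omega) (by omega)
  have hposj := ha.pos b j (by omega) (by omega)
  have hmi : some (b, i, 1) ∈ {y | H none y} := (hub_iff ha hH hposi).mpr (Or.inl ⟨hi1, hi0⟩)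
  have hmj : some (b, j, 1) ∈ {y | H none y} := (hub_iff ha hH hposj).mpr (Or.inr ⟨hj0, hj1⟩)
  have hD : ∀ b' m, Xor (Zl k h q H b' (m + 1)) (Zl k h q H b' m) ↔ (b' = b ∧ (m = i ∨ m = j)) := by
    intro b' m
    constructor
    · intro hx
      have hm : m ≤ k b' ∧ 1 ≤ k b' := by
        rcases hx with hx | hx
        · have := Zl_lt hx.1; omega
        · have := Zl_lt hx.1; omega
      have hmm : some (b', m, 1) ∈ {y | H none y} :=
        (hub_iff ha hH (ha.pos b' m hm.2 hm.1)).mpr hx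
      rcases hH.deg none with he | he
      · rw [he] at hmm; exact hmm.elim
      · obtain ⟨x, y, hxy, he⟩ := Set.ncard_eq_two.mp he
        rw [he] at hmm hmi hmj
        simp only [Set.mem_insert_iff, Set.mem_singleton_iff] at hmm hmi hmj
        have hne : (some (b, i, 1) : Option (ι × ℕ × ℕ)) ≠ some (b, j, 1) := by
          simp; omega
        have : (some (b', m, 1) : Option (ι × ℕ × ℕ)) = some (b, i, 1) ∨
            (some (b', m, 1) : Option (ι × ℕ × ℕ)) = some (b, j, 1) := by
          grind
        rcases this with h5 | h5
        · simp at h5; exact ⟨h5.1, Or.inl h5.2⟩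
        · simp at h5; exact ⟨h5.1, Or.inr h5.2⟩
    · rintro ⟨rfl, rfl | rfl⟩
      · exact Or.inl ⟨hi1, hi0⟩
      · exact Or.inr ⟨hj0, hj1⟩
  refine ⟨b, i, j, by omega, by omega, ?_⟩
  intro b' l
  induction l with
  | zero => simp [Zl]
  | succ l ih =>
    have h1 := hD b' l
    have h2 : Zl k h q H b' (l + 1) ↔ Xor (Zl k h q H b' l) (b' = b ∧ (l = i ∨ l = j)) := by
      rw [← h1]
      simp only [Xor]
      tauto
    rw [h2, ih]
    by_cases hb : b' = b
    · simp only [hb, true_and, Xor]; omega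
    · simp [hb]

lemma H_det (ha : Adm k h q) {H' : Option (ι × ℕ × ℕ) → Option (ι × ℕ × ℕ) → Prop}
    (hH : EvenSub k h q H) (hH' : EvenSub k h q H')
    (hZ : ∀ b l, Zl k h q H b l ↔ Zl k h q H' b l) (x y : Option (ι × ℕ × ℕ)) (hxy : H x y) :
    H' x y := by
  have key : ∀ x y, H x y → ((∃ b m s, m ≤ k b ∧ s < h b m ∧ x = pt b m s ∧ y = pt b m (s + 1)) ∨
      (∃ b m, m < k b ∧ x = pt b m (h b m) ∧ y = pt b (m + 1) (q b (m + 1)))) → H' x y := by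
    rintro x y hxy (⟨b, m, s, h1, h2, rfl, rfl⟩ | ⟨b, m, h1, rfl, rfl⟩)
    · rw [tree_iff ha hH (h b m - s - 1) s (by omega)] at hxy
      rw [tree_iff ha hH' (h b m - s - 1) s (by omega)]
      simpa only [hZ] using hxy
    · exact ((hZ b (m + 1)).mp ⟨h1, hxy⟩).2
  have hadj := hH.sub _ _ hxy
  unfold spider at hadj
  rw [SimpleGraph.fromRel_adj] at hadj
  rcases hadj.2 with h1 | h1
  · exact key x y hxy h1
  · exact hH'.symm _ _ (key y x (hH.symm _ _ hxy) h1)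

/-- lowest vertex of the cycle `(i, j)` in leg `l` -/
def lo (q : ι → ℕ → ℕ) (b : ι) (i j l : ℕ) : ℕ := if l = i ∨ l = j then 1 else q b l
/-- highest vertex of the cycle `(i, j)` in leg `l` -/
def hi (h q : ι → ℕ → ℕ) (b : ι) (j l : ℕ) : ℕ := if l = j then q b l else h b l

/-- length of the cycle `(b, i, j)` -/
def len (h q : ι → ℕ → ℕ) (b : ι) (i j : ℕ) : ℕ :=
  1 + ∑ l ∈ Finset.Icc i j, (hi h q b j l + 1 - lo q b i j l)

lemma supp_iff (ha : Adm k h q) (hH : EvenSub k h q H) {b : ι} {i j : ℕ} (hij : i < j)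
    (hjk : j ≤ k b) (hZ : ∀ b' l, Zl k h q H b' l ↔ (b' = b ∧ i < l ∧ l ≤ j))
    (v : Option (ι × ℕ × ℕ)) :
    (∃ y, H v y) ↔ (v = none ∨ ∃ l s, v = some (b, l, s) ∧ i ≤ l ∧ l ≤ j ∧
      lo q b i j l ≤ s ∧ s ≤ hi h q b j l) := by
  rcases v with _ | ⟨b', l, s⟩
  · simp only [true_or, iff_true]
    refine ⟨some (b, i, 1), (hub_iff ha hH (ha.pos b i (by omega) (by omega))).mpr (Or.inl ?_)⟩
    rw [hZ, hZ]
    simp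
    omega
  · have hqj : ∀ l, 1 ≤ l → l ≤ k b → 1 ≤ q b l ∧ q b l ≤ h b l := by
      intro l h1 h2
      obtain ⟨l, rfl⟩ : ∃ l', l = l' + 1 := ⟨l - 1, by omega⟩
      exact ha.1 b l h2
    have key : (∃ y, H (some (b', l, s)) y) ↔ (b' = b ∧ i ≤ l ∧ l ≤ j ∧
      lo q b i j l ≤ s ∧ s ≤ hi h q b j l) := by
      cases s with
      | zero =>
        constructor
        · rintro ⟨y, hy⟩
          have := (spider_nbr ha (hH.sub _ _ hy)).1
          omega
        · rintro ⟨rfl, h1, h2, h3, h4⟩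
          exfalso
          unfold lo at h3
          split_ifs at h3 with h5
          · omega
          · have := hqj l (by omega) (by omega)
            omega
      | succ s =>
        by_cases hv : l ≤ k b' ∧ s + 1 ≤ h b' l
        · have e1 : (∃ y, H (some (b', l, s + 1)) y) ↔
            (H (some (b', l, s + 1)) (upv h q b' l (s + 1)) ∨
              H (some (b', l, s + 1)) (sidev h b' l)) := by
            constructor
            · rintro ⟨y, hy⟩
              rcases nbr_three ha hH hy with rfl | rfl | rfl
              · have h5 := (step ha hH hv.2).mp (hH.symm _ _ hy)
                rw [← mem_side ha hH, ← mem_up ha hH hv.2] at h5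
                rcases h5 with h5 | h5
                · exact Or.inl h5.1
                · exact Or.inr h5.1
              · exact Or.inl hy
              · exact Or.inr hy
            · rintro (h5 | h5)
              · exact ⟨_, h5⟩
              · exact ⟨_, h5⟩
          rw [e1, mem_side ha hH, mem_up ha hH hv.2]
          have e2 : (s + 1 < h b' l ∧ H (pt b' l (s + 1)) (pt b' l (s + 2))) ↔
              (s + 1 < h b' l ∧ if s + 1 < q b' l then
                Xor (Zl k h q H b' (l + 1)) (Zl k h q H b' l) else Zl k h q H b' (l + 1)) := by
            apply and_congr_right
            intro h5
            exact tree_iff ha hH (h b' l - s - 2) (s + 1) (by omega)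
          rw [e2]
          simp only [hZ, lo, hi]
          by_cases hb : b' = b
          · subst hb
            simp only [true_and, Xor]
            by_cases hl : 1 ≤ l
            · have h6 := hqj l hl hv.1
              split_ifs <;> omega
            · split_ifs <;> omega
          · simp [hb, Xor]
        · constructor
          · rintro ⟨y, hy⟩
            have := spider_nbr ha (hH.sub _ _ hy)
            exact absurd ⟨this.2.1, this.2.2.1⟩ hv
          · rintro ⟨rfl, h1, h2, h3, h4⟩
            exfalso
            apply hv
            refine ⟨by omega, ?_⟩
            unfold hi at h4
            split_ifs at h4 with h5
            · have := hqj l (by omega) (by omega)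
              omega
            · exact h4
    rw [key]
    constructor
    · rintro ⟨rfl, h1⟩
      exact Or.inr ⟨l, s, rfl, h1⟩
    · rintro (h1 | ⟨l', s', h1, h2⟩)
      · cases h1
      · simp only [Option.some.injEq, Prod.mk.injEq] at h1
        obtain ⟨rfl, rfl, rfl⟩ := h1
        exact ⟨rfl, h2⟩

lemma cycle_even {u : Option (ι × ℕ × ℕ)} (w : (spider k h q).Walk u u)
    (hw : w.IsCycle) : EvenSub k h q w.toSubgraph.Adj where
  symm := fun x y hxy => hxy.symm
  sub := fun x y hxy => hxy.adj_sub
  deg := by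
    intro x
    by_cases hx : x ∈ w.support
    · right
      exact hw.ncard_neighborSet_toSubgraph_eq_two hx
    · left
      ext y
      simp only [Set.mem_ofPred_eq, Set.mem_empty_iff_false, iff_false]
      intro hxy
      exact hx ((Walk.mem_verts_toSubgraph w).mp hxy.fst_mem)
  ne := by
    have h2 := hw.ncard_neighborSet_toSubgraph_eq_two w.start_mem_support
    have : (w.toSubgraph.neighborSet u).Nonempty := by
      rw [← Set.ncard_pos (Set.finite_of_ncard_pos (by omega))]
      omega
    obtain ⟨y, hy⟩ := this
    exact ⟨u, y, hy⟩

lemma cycle_len (ha : Adm k h q) {u : Option (ι × ℕ × ℕ)} (w : (spider k h q).Walk u u)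
    (hw : w.IsCycle) {b : ι} {i j : ℕ} (hij : i < j)
    (hjk : j ≤ k b) (hZ : ∀ b' l, Zl k h q w.toSubgraph.Adj b' l ↔ (b' = b ∧ i < l ∧ l ≤ j)) :
    w.length = len h q b i j := by
  classical
  have hH := cycle_even w hw
  have h1 : w.length = w.support.tail.toFinset.card := by
    rw [List.toFinset_card_of_nodup hw.support_nodup, List.length_tail, Walk.length_support]
    rfl
  have h2 : w.support.tail.toFinset = insert none (((Finset.Icc i j).sigma
      (fun l => Finset.Icc (lo q b i j l) (hi h q b j l))).image
      (fun p : (_ : ℕ) × ℕ => (some (b, p.1, p.2) : Option (ι × ℕ × ℕ)))) := by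
    ext v
    have h3 : v ∈ w.support.tail.toFinset ↔ ∃ y, w.toSubgraph.Adj v y := by
      rw [List.mem_toFinset]
      constructor
      · intro hv
        have hv' := List.mem_of_mem_tail hv
        have h2 := hw.ncard_neighborSet_toSubgraph_eq_two hv'
        have : (w.toSubgraph.neighborSet v).Nonempty := by
          rw [← Set.ncard_pos (Set.finite_of_ncard_pos (by omega))]
          omega
        exact this
      · rintro ⟨y, hy⟩
        have hv : v ∈ w.support := (Walk.mem_verts_toSubgraph w).mp hy.fst_mem
        rcases (Walk.mem_support_iff w).mp hv with rfl | hv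
        · exact Walk.end_mem_tail_support hw.not_nil
        · exact hv
    rw [h3, supp_iff ha hH hij hjk hZ]
    simp only [Finset.mem_insert, Finset.mem_image, Finset.mem_sigma, Finset.mem_Icc,
      Sigma.exists]
    apply or_congr_right
    constructor
    · rintro ⟨l, s, rfl, h4, h5, h6, h7⟩
      exact ⟨l, s, ⟨⟨h4, h5⟩, h6, h7⟩, rfl⟩
    · rintro ⟨l, s, ⟨⟨h4, h5⟩, h6, h7⟩, rfl⟩
      exact ⟨l, s, rfl, h4, h5, h6, h7⟩
  rw [h1, h2, Finset.card_insert_of_notMem, Finset.card_image_of_injective, Finset.card_sigma, len,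
    add_comm]
  · simp
  · rintro ⟨a, c⟩ ⟨a', c'⟩ he
    simp at he
    obtain ⟨rfl, rfl⟩ := he
    rfl
  · simp

/-- If the parameters give pairwise different lengths, the spider has distinct cycle lengths. -/
theorem spider_distinct (ha : Adm k h q)
    (hinj : ∀ b i j b' i' j', i < j → j ≤ k b → i' < j' → j' ≤ k b' →
      len h q b i j = len h q b' i' j' → b = b' ∧ i = i' ∧ j = j') :
    distinctCycleLengths (spider k h q) := by
  intro u v w w' hw hw' hl
  have hH := cycle_even w hw
  have hH' := cycle_even w' hw'
  obtain ⟨b, i, j, h1, h2, hZ⟩ := Zl_interval ha hH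
  obtain ⟨b', i', j', h1', h2', hZ'⟩ := Zl_interval ha hH'
  rw [cycle_len ha w hw h1 h2 hZ, cycle_len ha w' hw' h1' h2' hZ'] at hl
  obtain ⟨rfl, rfl, rfl⟩ := hinj _ _ _ _ _ _ h1 h2 h1' h2' hl
  have hZZ : ∀ b l, Zl k h q w.toSubgraph.Adj b l ↔ Zl k h q w'.toSubgraph.Adj b l := by
    intro b l; rw [hZ, hZ']
  ext e
  induction e using Sym2.ind with
  | _ x y =>
    simp only [Set.mem_ofPred_eq, ← Walk.adj_toSubgraph_iff_mem_edges]
    exact ⟨H_det ha hH hH' hZZ x y, H_det ha hH' hH (fun b l => (hZZ b l).symm) x y⟩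

end Spider


section Construction

/-- coefficient table of the leg heights -/
def hc (t m : ℕ) : ℕ :=
  (([[14, 31, 35, 23, 13, 15], [15, 30, 41, 22, 14, 16], [16, 36, 30, 25, 15, 17],
    [17, 35, 36, 24, 16, 18]] : List (List ℕ)).getD t []).getD m 0
/-- offset table of the leg heights -/
def ho (t m : ℕ) : ℕ :=
  (([[1, 0, 0, 0, 1, 0], [1, 0, 0, 1, 1, 0], [1, 0, 1, 1, 1, 0],
    [1, 0, 1, 0, 1, 0]] : List (List ℕ)).getD t []).getD m 0
/-- coefficient table of the link heights -/
def qc (t m : ℕ) : ℕ :=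
  (([[0, 14, 15, 15, 13, 15], [0, 15, 18, 9, 14, 16], [0, 16, 16, 14, 15, 17],
    [0, 17, 19, 8, 16, 18]] : List (List ℕ)).getD t []).getD m 0
/-- offset table of the link heights -/
def qo (t m : ℕ) : ℕ :=
  (([[0, 1, 1, 1, 1, 0], [0, 1, 1, 2, 1, 0], [0, 1, 2, 2, 1, 0],
    [0, 1, 2, 1, 1, 0]] : List (List ℕ)).getD t []).getD m 0
/-- cell table of the cycle lengths -/
def lc (t i j : ℕ) : ℕ := (([[0, 14, 23, 33, 36, 37, 0, 0, 23, 33, 36, 37, 0, 0, 0, 25, 28, 29, 0, 0, 0, 0, 18, 19, 0, 0, 0, 0, 0, 14, 0, 0, 0, 0, 0, 0],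
    [0, 15, 24, 31, 40, 41, 0, 0, 24, 31, 40, 41, 0, 0, 0, 25, 34, 35, 0, 0, 0, 0, 18, 19, 0, 0, 0, 0, 0, 15, 0, 0, 0, 0, 0, 0],
    [0, 16, 26, 32, 38, 39, 0, 0, 26, 32, 38, 39, 0, 0, 0, 22, 28, 29, 0, 0, 0, 0, 20, 21, 0, 0, 0, 0, 0, 16, 0, 0, 0, 0, 0, 0],
    [0, 17, 27, 30, 42, 43, 0, 0, 27, 30, 42, 43, 0, 0, 0, 22, 34, 35, 0, 0, 0, 0, 20, 21, 0, 0, 0, 0, 0, 17, 0, 0, 0, 0, 0, 0]] : List (List ℕ)).getD t []).getD (6 * i + j) 0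
/-- offset table of the cycle lengths -/
def leo (t i j : ℕ) : ℕ := (([[0, 1, 1, 1, 1, 1, 0, 0, 0, 0, 0, 0, 0, 0, 0, 0, 0, 0, 0, 0, 0, 0, 0, 0, 0, 0, 0, 0, 0, 0, 0, 0, 0, 0, 0, 0],
    [0, 1, 1, 2, 1, 1, 0, 0, 0, 1, 0, 0, 0, 0, 0, 1, 0, 0, 0, 0, 0, 0, 1, 1, 0, 0, 0, 0, 0, 0, 0, 0, 0, 0, 0, 0],
    [0, 1, 2, 2, 1, 1, 0, 0, 1, 1, 0, 0, 0, 0, 0, 2, 1, 1, 0, 0, 0, 0, 1, 1, 0, 0, 0, 0, 0, 0, 0, 0, 0, 0, 0, 0],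
    [0, 1, 2, 1, 1, 1, 0, 0, 1, 0, 0, 0, 0, 0, 0, 1, 1, 1, 0, 0, 0, 0, 0, 0, 0, 0, 0, 0, 0, 0, 0, 0, 0, 0, 0, 0]] : List (List ℕ)).getD t []).getD (6 * i + j) 0

/-- index type of the blocks -/
abbrev Idx (R : ℕ) := Fin (28 * R + 53) ⊕ ((Fin 4 × Fin R) ⊕ Unit)

/-- number of links -/
def ck (R : ℕ) : Idx R → ℕ
  | .inl _ => 1
  | .inr (.inl _) => 5
  | .inr (.inr _) => 0

/-- heights -/
def chh (R p : ℕ) : Idx R → ℕ → ℕ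
  | .inl a, m => if m = 0 then 1 else a.val + 1
  | .inr (.inl x), m => hc x.1.val m * (R + 2) + x.2.val + ho x.1.val m
  | .inr (.inr _), _ => p

/-- link heights -/
def cq (R : ℕ) : Idx R → ℕ → ℕ
  | .inl a, _ => a.val + 1
  | .inr (.inl x), m => qc x.1.val m * (R + 2) + x.2.val + qo x.1.val m
  | .inr (.inr _), _ => 0

lemma adm_c (R p : ℕ) : Adm (ck R) (chh R p) (cq R) := by
  constructor
  · rintro (a | ⟨⟨t, ht⟩, r, hr⟩ | u) m hm
    · simp only [ck] at hm
      simp [chh, cq]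
    · simp only [ck] at hm
      simp only [chh, cq]
      interval_cases t <;> interval_cases m <;> simp [hc, ho, qc, qo] <;> omega
    · simp [ck] at hm
  · rintro (a | ⟨⟨t, ht⟩, r, hr⟩ | u) hm
    · simp [chh]
    · simp only [chh]
      interval_cases t <;> simp [hc, ho]
    · simp [ck] at hm

lemma len_cyc (R p : ℕ) (a : Fin (28 * R + 53)) :
    len (chh R p) (cq R) (.inl a) 0 1 = a.val + 3 := by
  simp [len, lo, hi, chh, cq, Finset.sum_Icc_succ_top]
  omega

set_option maxHeartbeats 4000000 in
lemma len_blk (R p : ℕ) (t : Fin 4) (r : Fin R) (i j : ℕ) (hij : i < j) (hj : j ≤ 5) :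
    len (chh R p) (cq R) (.inr (.inl (t, r))) i j =
      2 * lc t.val i j * (R + 2) + 2 * r.val + 2 + leo t.val i j := by
  obtain ⟨t, ht⟩ := t
  obtain ⟨r, hr⟩ := r
  simp only [len, lo, hi, chh, cq]
  interval_cases t <;> interval_cases j <;> interval_cases i <;>
    simp [Finset.sum_Icc_succ_top, hc, ho, qc, qo, lc, leo] <;> omega

lemma tab_range : ∀ t : Fin 4, ∀ i j : Fin 6, i < j →
    14 ≤ lc t.val i.val j.val ∧ leo t.val i.val j.val ≤ 2 := by
  decide

/-- inverse table: recovers `36 t + 6 i + j` from the cell and the parity -/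
def dtab (c : ℕ) : ℕ := ([29, 1, 65, 37, 101, 73, 137, 109, 22, 58, 23, 59,
    130, 94, 131, 95, 87, 123, 8, 2, 44, 38, 15, 51,
    74, 80, 110, 116, 16, 88, 17, 89, 117, 111, 39, 45,
    75, 81, 9, 3, 52, 124, 53, 125, 10, 4, 11, 5,
    82, 76, 83, 77, 46, 40, 47, 41, 118, 112, 119, 113] : List ℕ).getD (c - 28) 0

lemma tab_dec : ∀ t : Fin 4, ∀ i j : Fin 6, i < j →
    dtab (2 * lc t.val i.val j.val + leo t.val i.val j.val % 2) =
      36 * t.val + 6 * i.val + j.val := by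
  decide

lemma tab_inj (t : Fin 4) (i j : Fin 6) (t' : Fin 4) (i' j' : Fin 6) (h1 : i < j) (h1' : i' < j')
    (hC : lc t.val i.val j.val = lc t'.val i'.val j'.val)
    (hE : leo t.val i.val j.val % 2 = leo t'.val i'.val j'.val % 2) :
    t = t' ∧ i = i' ∧ j = j' := by
  have e1 := tab_dec t i j h1
  have e2 := tab_dec t' i' j' h1'
  rw [hC, hE, e2] at e1
  simp only [Fin.ext_iff]
  omega

lemma c_distinct (R p : ℕ) : distinctCycleLengths (spider (ck R) (chh R p) (cq R)) := by
  apply spider_distinct (adm_c R p)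
  rintro (a | ⟨t, r⟩ | u) i j (a' | ⟨t', r'⟩ | u') i' j' h1 h2 h1' h2' hl
  · simp only [ck] at h2 h2'
    obtain ⟨rfl, rfl⟩ : i = 0 ∧ j = 1 := by omega
    obtain ⟨rfl, rfl⟩ : i' = 0 ∧ j' = 1 := by omega
    rw [len_cyc, len_cyc] at hl
    have : a = a' := Fin.ext (by omega)
    simp [this]
  · simp only [ck] at h2 h2'
    obtain ⟨rfl, rfl⟩ : i = 0 ∧ j = 1 := by omega
    rw [len_cyc, len_blk _ _ _ _ _ _ h1' h2'] at hl
    have := (tab_range t' ⟨i', by omega⟩ ⟨j', by omega⟩ h1').1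
    simp only at this
    have ha := a.2
    have : 2 * 14 * (R + 2) ≤ 2 * lc t'.val i' j' * (R + 2) := by gcongr
    omega
  · simp only [ck] at h2'; omega
  · simp only [ck] at h2 h2'
    obtain ⟨rfl, rfl⟩ : i' = 0 ∧ j' = 1 := by omega
    rw [len_cyc, len_blk _ _ _ _ _ _ h1 h2] at hl
    have := (tab_range t ⟨i, by omega⟩ ⟨j, by omega⟩ h1).1
    simp only at this
    have ha := a'.2
    have : 2 * 14 * (R + 2) ≤ 2 * lc t.val i j * (R + 2) := by gcongr
    omega
  · simp only [ck] at h2 h2'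
    rw [len_blk _ _ _ _ _ _ h1' h2', len_blk _ _ _ _ _ _ h1 h2] at hl
    have e1 := (tab_range t ⟨i, by omega⟩ ⟨j, by omega⟩ h1).2
    have e2 := (tab_range t' ⟨i', by omega⟩ ⟨j', by omega⟩ h1').2
    have e3 := tab_inj t ⟨i, by omega⟩ ⟨j, by omega⟩ t' ⟨i', by omega⟩ ⟨j', by omega⟩ h1 h1'
    simp only at e1 e2 e3
    have e8 : (t = t' ∧ i = i' ∧ j = j') → leo t.val i j = leo t'.val i' j' := by
      rintro ⟨rfl, rfl, rfl⟩; rfl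
    have hr := r.2
    have hr' := r'.2
    generalize lc t.val i j = C at *
    generalize lc t'.val i' j' = C' at *
    generalize leo t.val i j = E at *
    generalize leo t'.val i' j' = E' at *
    have hC : C = C' := by
      rcases lt_trichotomy C C' with h | h | h
      · have : 2 * (C + 1) * (R + 2) ≤ 2 * C' * (R + 2) := by gcongr; omega
        nlinarith
      · exact h
      · have : 2 * (C' + 1) * (R + 2) ≤ 2 * C * (R + 2) := by gcongr; omega
        nlinarith
    subst hC
    have e4 := e3 rfl (by omega)
    obtain ⟨rfl, e5, e6⟩ := e4
    simp only [Fin.mk.injEq] at e5 e6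
    subst e5 e6
    have e9 := e8 ⟨rfl, rfl, rfl⟩
    have hE : r = r' := Fin.ext (by omega)
    simp [hE]
  · simp only [ck] at h2'; omega
  · simp only [ck] at h2; omega
  · simp only [ck] at h2; omega
  · simp only [ck] at h2; omega

end Construction

section Transport

lemma distinct_comap {V W : Type*} (φ : V ↪ W) (G : SimpleGraph W) (hG : distinctCycleLengths G) :
    distinctCycleLengths (G.comap φ) := by
  intro u v w w' hw hw' hl
  let e : G.comap φ ↪g G := SimpleGraph.Embedding.comap φ G
  have hinj : Function.Injective e.toHom := e.injective
  have h1 := hG _ _ (w.map e.toHom) (w'.map e.toHom) (hw.map hinj) (hw'.map hinj)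
    (by rw [Walk.length_map, Walk.length_map, hl])
  ext x
  have h2 := Set.ext_iff.mp h1 (Sym2.map e.toHom x)
  simp only [Set.mem_ofPred_eq, Walk.edges_map,
    List.mem_map_of_injective (Sym2.map.injective hinj)] at h2 ⊢
  exact h2

variable {ι : Type*} {k : ι → ℕ} {h q : ι → ℕ → ℕ}

/-- the edge indexed by `(b, m, s)` -/
def edg (h q : ι → ℕ → ℕ) (x : ι × ℕ × ℕ) : Sym2 (Option (ι × ℕ × ℕ)) :=
  if x.2.2 = 0 then s(pt x.1 (x.2.1 - 1) (h x.1 (x.2.1 - 1)), pt x.1 x.2.1 (q x.1 x.2.1))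
  else s(pt x.1 x.2.1 (x.2.2 - 1), pt x.1 x.2.1 x.2.2)

/-- valid edge indices -/
def EI (k : ι → ℕ) (h : ι → ℕ → ℕ) : Set (ι × ℕ × ℕ) :=
  {x | x.2.1 ≤ k x.1 ∧ x.2.2 ≤ h x.1 x.2.1 ∧ (x.2.1 = 0 → x.2.2 ≠ 0)}

lemma edg_inj (ha : Adm k h q) : Set.InjOn (edg h q) (EI k h) := by
  rintro ⟨b, m, s⟩ ⟨h1, h2, h3⟩ ⟨b', m', s'⟩ ⟨h1', h2', h3'⟩ he
  simp only at h1 h2 h3 h1' h2' h3'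
  have L : ∀ b m, m ≤ k b → m ≠ 0 →
      pt b (m - 1) (h b (m - 1)) = some (b, m - 1, h b (m - 1)) ∧
      pt b m (q b m) = some (b, m, q b m) := by
    intro b m hm h0
    refine ⟨pt_pos _ _ _ (ha.pos b _ (by omega) (by omega)), pt_pos _ _ _ ?_⟩
    obtain ⟨m, rfl⟩ : ∃ m', m = m' + 1 := ⟨m - 1, by omega⟩
    exact (ha.1 b m hm).1
  unfold edg at he
  simp only at he
  have key : b = b' ∧ m = m' ∧ s = s' := by
    split_ifs at he with c1 c2 c2
    · have hm : m ≠ 0 := fun h0 => h3 h0 c1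
      have hm' : m' ≠ 0 := fun h0 => h3' h0 c2
      rw [(L b m h1 hm).1, (L b m h1 hm).2, (L b' m' h1' hm').1, (L b' m' h1' hm').2,
        Sym2.eq_iff] at he
      simp only [Option.some.injEq, Prod.mk.injEq] at he
      rcases he with ⟨_, h5, h6, _⟩ | ⟨⟨_, h5, _⟩, _, h6, _⟩
      · exact ⟨h5, h6, by omega⟩
      · omega
    · have hm : m ≠ 0 := fun h0 => h3 h0 c1
      rw [(L b m h1 hm).1, (L b m h1 hm).2, Sym2.eq_iff, pt_eq_some, pt_eq_some, pt_eq_some,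
        pt_eq_some] at he
      omega
    · have hm' : m' ≠ 0 := fun h0 => h3' h0 c2
      rw [eq_comm, (L b' m' h1' hm').1, (L b' m' h1' hm').2, Sym2.eq_iff, pt_eq_some, pt_eq_some,
        pt_eq_some, pt_eq_some] at he
      omega
    · rw [Sym2.eq_iff, pt_pos b m s (by omega), pt_pos b' m' s' (by omega)] at he
      rcases he with ⟨_, h5⟩ | ⟨h5, h6⟩
      · simp only [Option.some.injEq, Prod.mk.injEq] at h5
        exact h5
      · have h7 := pt_eq_some.mp h5.symm
        have h8 := pt_eq_some.mp h6
        omega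
  obtain ⟨rfl, rfl, rfl⟩ := key
  rfl

lemma edg_mem (ha : Adm k h q) {x : ι × ℕ × ℕ} (hx : x ∈ EI k h) :
    edg h q x ∈ (spider k h q).edgeSet := by
  obtain ⟨b, m, s⟩ := x
  obtain ⟨h1, h2, h3⟩ := hx
  simp only at h1 h2 h3
  unfold edg
  simp only
  split_ifs with c
  · obtain ⟨m, rfl⟩ : ∃ m', m = m' + 1 := ⟨m - 1, by omega⟩
    exact spider_link ha h1
  · obtain ⟨s, rfl⟩ : ∃ s', s = s' + 1 := ⟨s - 1, by omega⟩
    exact spider_tree h1 h2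

variable [Fintype ι]

/-- valid vertices -/
def VS (k : ι → ℕ) (h : ι → ℕ → ℕ) : Finset (Option (ι × ℕ × ℕ)) :=
  Finset.cons none (((Finset.univ : Finset ι).sigma (fun b => (Finset.range (k b + 1)).sigma
    (fun m => Finset.Icc 1 (h b m)))).map
      ⟨fun x : (_ : ι) × (_ : ℕ) × ℕ => (some (x.1, x.2.1, x.2.2) : Option (ι × ℕ × ℕ)), by
        rintro ⟨a, b, c⟩ ⟨a', b', c'⟩ he
        simp at he
        obtain ⟨rfl, rfl, rfl⟩ := he
        rfl⟩) (by simp)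

/-- valid edge indices, as a finset -/
def ES (k : ι → ℕ) (h : ι → ℕ → ℕ) : Finset (ι × ℕ × ℕ) :=
  ((Finset.univ : Finset ι).sigma (fun b => (Finset.range (k b + 1)).sigma
    (fun m => Finset.Icc (if m = 0 then 1 else 0) (h b m)))).map
      ⟨fun x : (_ : ι) × (_ : ℕ) × ℕ => ((x.1, x.2.1, x.2.2) : (ι × ℕ × ℕ)), by
        rintro ⟨a, b, c⟩ ⟨a', b', c'⟩ he
        simp at he
        obtain ⟨rfl, rfl, rfl⟩ := he
        rfl⟩

lemma VS_card : (VS k h).card = (∑ b, ∑ m ∈ Finset.range (k b + 1), h b m) + 1 := by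
  simp [VS, Finset.card_cons, Finset.card_sigma]

lemma ES_card : (ES k h).card = (∑ b, ∑ m ∈ Finset.range (k b + 1), h b m) + ∑ b, k b := by
  unfold ES
  rw [Finset.card_map, Finset.card_sigma, ← Finset.sum_add_distrib]
  refine Finset.sum_congr rfl fun b _ => ?_
  rw [Finset.card_sigma, Finset.sum_range_succ', Finset.sum_range_succ' (fun m => h b m)]
  simp [Finset.sum_add_distrib]
  omega

lemma mem_VS_none : none ∈ VS k h := by simp [VS]

lemma mem_VS_some {b : ι} {m s : ℕ} (h1 : m ≤ k b) (h2 : 1 ≤ s) (h3 : s ≤ h b m) :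
    some (b, m, s) ∈ VS k h := by
  simp only [VS, Finset.mem_cons, Finset.mem_map, Finset.mem_sigma, Finset.mem_Icc,
    Finset.mem_range]
  exact Or.inr ⟨⟨b, m, s⟩, ⟨Finset.mem_univ _, by simp only; omega, h2, h3⟩, rfl⟩

lemma mem_ES {x : ι × ℕ × ℕ} (hx : x ∈ ES k h) : x ∈ EI k h := by
  simp only [ES, Finset.mem_map, Finset.mem_sigma, Finset.mem_Icc,
    Finset.mem_range] at hx
  obtain ⟨⟨b, m, s⟩, ⟨_, h1, h2, h3⟩, rfl⟩ := hx
  simp only at h1 h2 h3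
  refine ⟨show m ≤ k b by omega, h3, fun h0 => ?_⟩
  change m = 0 at h0
  rw [if_pos h0] at h2
  exact show s ≠ 0 by omega

lemma adj_VS (ha : Adm k h q) {x y : Option (ι × ℕ × ℕ)} (hxy : (spider k h q).Adj x y) :
    x ∈ VS k h := by
  rcases x with _ | ⟨b, m, s⟩
  · exact mem_VS_none
  · have := spider_nbr ha hxy
    exact mem_VS_some this.2.1 this.1 this.2.2.1

theorem f_spider (ha : Adm k h q) (hd : distinctCycleLengths (spider k h q)) (n : ℕ)
    (hn : n = (∑ b, ∑ m ∈ Finset.range (k b + 1), h b m) + 1) :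
    n + ∑ b, k b ≤ f n + 1 := by
  classical
  have hc : (VS k h).card = n := by rw [VS_card, hn]
  let e : Fin n ≃ VS k h := ((VS k h).equivFinOfCardEq hc).symm
  let φ : Fin n ↪ Option (ι × ℕ × ℕ) := e.toEmbedding.trans (Function.Embedding.subtype _)
  have hφ : ∀ x ∈ VS k h, ∃ i, φ i = x := by
    intro x hx
    refine ⟨e.symm ⟨x, hx⟩, ?_⟩
    simp [φ]
  have h1 := le_f _ (distinct_comap φ _ hd)
  have h2 : (ES k h).card ≤ ((spider k h q).comap φ).edgeSet.ncard := by
    calc (ES k h).card = ((edg h q) '' (ES k h : Set (ι × ℕ × ℕ))).ncard := by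
          rw [Set.InjOn.ncard_image ((edg_inj ha).mono (fun x hx => mem_ES hx)),
            Set.ncard_coe_finset]
      _ ≤ (Sym2.map φ '' ((spider k h q).comap φ).edgeSet).ncard := by
          apply Set.ncard_le_ncard _ (Set.toFinite _)
          rintro _ ⟨x, hx, rfl⟩
          have h3 := edg_mem ha (mem_ES hx)
          revert h3
          generalize edg h q x = z
          induction z using Sym2.ind with
          | _ u v =>
            intro h3
            rw [SimpleGraph.mem_edgeSet] at h3
            obtain ⟨i, rfl⟩ := hφ u (adj_VS ha h3)
            obtain ⟨j, rfl⟩ := hφ v (adj_VS ha h3.symm)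
            exact ⟨s(i, j), h3, rfl⟩
      _ ≤ _ := Set.ncard_image_le (Set.toFinite _)
  rw [ES_card] at h2
  omega

end Transport

section Asymptotics

lemma gauss_fin (N : ℕ) : 2 * ∑ i : Fin N, i.val + N = N * N := by
  induction N with
  | zero => simp
  | succ N ih =>
    rw [Fin.sum_univ_castSucc]
    simp only [Fin.val_castSucc, Fin.val_last]
    nlinarith

lemma sum_ck (R : ℕ) : ∑ b, ck R b = 48 * R + 53 := by
  simp only [Fintype.sum_sum_type, ck]
  simp
  ring

lemma sum_chh (R p : ℕ) : 2 * ∑ b, ∑ m ∈ Finset.range (ck R b + 1), chh R p b m =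
    1916 * R ^ 2 + 5268 * R + 2968 + 2 * p := by
  simp only [Fintype.sum_sum_type, Fintype.sum_prod_type, ck, chh]
  simp only [Finset.sum_range_succ, Finset.sum_range_zero, Fin.sum_univ_four, Fin.val_zero,
    Fin.val_one, Fin.val_two]
  simp [hc, ho, Finset.sum_add_distrib]
  have h1 := gauss_fin (28 * R + 53)
  have h2 := gauss_fin R
  nlinarith

theorem f_lower (R n : ℕ) (hn : 958 * (R + 2) ^ 2 ≤ n) : n + (48 * R + 53) ≤ f n + 1 := by
  have h0 := sum_chh R 0
  have h1 := sum_chh R (n - 1 - ∑ b, ∑ m ∈ Finset.range (ck R b + 1), chh R 0 b m)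
  have h2 := f_spider (adm_c R (n - 1 - ∑ b, ∑ m ∈ Finset.range (ck R b + 1), chh R 0 b m))
    (c_distinct R _) n (by
      have : 958 * (R + 2) ^ 2 = 958 * R ^ 2 + 3832 * R + 3832 := by ring
      omega)
  rw [sum_ck] at h2
  exact h2


lemma cobdd : IsCoboundedUnder (· ≥ ·) atTop (fun n : ℕ => ((f n : ℝ) - n) / Real.sqrt n) := by
  apply IsBoundedUnder.isCoboundedUnder_ge
  refine ⟨5, ?_⟩
  rw [eventually_map]
  filter_upwards [eventually_ge_atTop 1] with n hn
  have h1 := f_upper hn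
  have h2 : 0 < Real.sqrt n := Real.sqrt_pos.mpr (by exact_mod_cast hn)
  rw [div_le_iff₀ h2]
  exact h1

lemma const_bound : Real.sqrt (2 + 40 / 99) ≤ 48 * 0.0323055 - 0.00001 := by
  apply Real.sqrt_le_iff.mpr
  norm_num

lemma ev_lower : ∀ᶠ n : ℕ in atTop, Real.sqrt (2 + 40 / 99) ≤ ((f n : ℝ) - n) / Real.sqrt n := by
  filter_upwards [eventually_ge_atTop 100000000000000] with n hn
  have hn' : (100000000000000 : ℝ) ≤ n := by exact_mod_cast hn
  set x := Real.sqrt n with hx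
  have hxx : x * x = n := Real.mul_self_sqrt (by positivity)
  have hx0 : 10000000 ≤ x := by
    rw [hx]; apply Real.le_sqrt_of_sq_le; norm_num; exact hn
  have hpos : 0 < x := by linarith
  set S := ⌊(0.0323055 : ℝ) * x⌋₊ with hS
  have hS1 : (S : ℝ) ≤ 0.0323055 * x := Nat.floor_le (by positivity)
  have hS2 : 0.0323055 * x < S + 1 := Nat.lt_floor_add_one _
  have hS3 : 2 ≤ S := by
    apply Nat.le_floor
    push_cast
    linarith
  obtain ⟨R, hR⟩ : ∃ R, S = R + 2 := ⟨S - 2, by omega⟩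
  have h1 := f_lower R n (by
    rw [← hR]
    have h2 : (958 * S ^ 2 : ℝ) ≤ n := by
      rw [← hxx]
      nlinarith [Nat.cast_nonneg (α := ℝ) S]
    exact_mod_cast h2)
  have h2 : (n : ℝ) + (48 * R + 53) ≤ f n + 1 := by exact_mod_cast h1
  have h3 : (S : ℝ) = R + 2 := by exact_mod_cast hR
  rw [le_div_iff₀ hpos]
  calc Real.sqrt (2 + 40 / 99) * x ≤ (48 * 0.0323055 - 0.00001) * x := by
        gcongr; exact const_bound
    _ ≤ (f n : ℝ) - n := by nlinarith

end Asymptotics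

theorem stmt8 :
    Real.sqrt (2 + 40 / 99) ≤
      atTop.liminf (fun n : ℕ => ((f n : ℝ) - n) / Real.sqrt n) := by
  exact le_liminf_of_le cobdd ev_lower
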